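/- Let p, q, r be integers and let M = !![p, r; 0, q] over ℤ. Then M can be written as A² − B² for some upper-triangular 2×2 integer matrices A and B if and only if one of the following holds: (1) p and q are odd, and either (p ≡ q (mod 4) and r ≡ 0 (mod 2)) or (p ≢ q (mod 4) and r is arbitrary); (2) one of p, q is odd and the other is divisible by 4, and r is arbitrary; (3) p ≡ q ≡ 0 (mod 4), and either ((p mod 16, q mod 16) ∈ {(4,4), (12,12)} and r ≡ 0 (mod 4)), or ((p mod 16, q mod 16) ∈ {(4,12), (8,8), (12,4)} and r ≡ 0 (mod 2)), or otherwise ((p mod 16, q mod 16) is divisible by 4 in both coordinates and in none of the previous five pairs) with r arbitrary. -/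

import Mathlib

/-- A 2×2 matrix is upper-triangular if its lower-left entry is 0. -/
def IsUpperTriangular {R : Type*} [Ring R] (A : Matrix (Fin 2) (Fin 2) R) : Prop :=
  A 1 0 = 0

/-- `T` is representable as a difference of two squares of upper-triangular matrices. -/
def ReprDiffSqUT {R : Type*} [Ring R] (T : Matrix (Fin 2) (Fin 2) R) : Prop :=
  ∃ A B : Matrix (Fin 2) (Fin 2) R,
    IsUpperTriangular A ∧ IsUpperTriangular B ∧ T = A ^ 2 - B ^ 2

theorem reprDiffSqUT_iff {R : Type*} [CommRing R] {p q r : R} :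
    ReprDiffSqUT !![p, r; 0, q] ↔
      ∃ a b d e x y : R, p = a ^ 2 - b ^ 2 ∧ q = d ^ 2 - e ^ 2 ∧
        r = x * (a + d) - y * (b + e) := by
  constructor
  · rintro ⟨A, B, hA, hB, h⟩
    unfold IsUpperTriangular at hA hB
    have h00 := congrFun (congrFun h 0) 0
    have h01 := congrFun (congrFun h 0) 1
    have h11 := congrFun (congrFun h 1) 1
    simp only [pow_two, Matrix.sub_apply, Matrix.mul_apply, Fin.sum_univ_two, hA, hB,
      Matrix.of_apply, Matrix.cons_val_zero, Matrix.cons_val_one,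
      Matrix.cons_val', Matrix.cons_val_fin_one] at h00 h01 h11
    exact ⟨A 0 0, B 0 0, A 1 1, B 1 1, A 0 1, B 0 1, by rw [h00]; ring, by rw [h11]; ring,
      by rw [h01]; ring⟩
  · rintro ⟨a, b, d, e, x, y, rfl, rfl, rfl⟩
    refine ⟨!![a, x; 0, d], !![b, y; 0, e], rfl, rfl, ?_⟩
    ext i j
    fin_cases i <;> fin_cases j <;> simp [pow_two]
    ring

theorem ReprDiffSqUT.swap {R : Type*} [CommRing R] {p q r : R}
    (h : ReprDiffSqUT !![p, r; 0, q]) : ReprDiffSqUT !![q, r; 0, p] := by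
  obtain ⟨a, b, d, e, x, y, hp, hq, hr⟩ := reprDiffSqUT_iff.1 h
  exact reprDiffSqUT_iff.2 ⟨d, e, a, b, x, y, hq, hp, by rw [hr]; ring⟩

theorem reprDiffSqUT_odd_odd_of_even {m n k : ℤ} :
    ReprDiffSqUT !![2 * m + 1, 2 * k; 0, 2 * n + 1] :=
  reprDiffSqUT_iff.2 ⟨m + 1, m, n + 1, n, k, k, by ring, by ring, by ring⟩

theorem reprDiffSqUT_odd_odd_of_odd_add {m n r j : ℤ} (h : m + n = 2 * j + 1) :
    ReprDiffSqUT !![2 * m + 1, r; 0, 2 * n + 1] :=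
  reprDiffSqUT_iff.2 ⟨m + 1, m, n + 1, n, -j * r, -j * r - r, by ring, by ring,
    by linear_combination -r * h⟩

theorem reprDiffSqUT_odd_four_mul {m n r : ℤ} :
    ReprDiffSqUT !![2 * m + 1, r; 0, 4 * n] :=
  reprDiffSqUT_iff.2 ⟨m + 1, m, -(1 + n), 1 - n, -r, -r, by ring, by ring, by ring⟩

theorem reprDiffSqUT_four_mul_of_four_dvd {m n k : ℤ} :
    ReprDiffSqUT !![4 * m, 4 * k; 0, 4 * n] :=
  reprDiffSqUT_iff.2 ⟨m + 1, m - 1, n + 1, n - 1, k, k, by ring, by ring, by ring⟩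

theorem reprDiffSqUT_four_mul_of_even {m n j k : ℤ} (h : m + n = 4 * j) :
    ReprDiffSqUT !![4 * m, 2 * k; 0, 4 * n] :=
  reprDiffSqUT_iff.2 ⟨m + 1, m - 1, n + 1, n - 1, k * (1 - j), -j * k, by ring, by ring,
    by linear_combination -k * h⟩

theorem reprDiffSqUT_four_mul_of_odd_add {m n j r : ℤ} (h : m + n = 2 * j + 1) :
    ReprDiffSqUT !![4 * m, r; 0, 4 * n] :=
  reprDiffSqUT_iff.2 ⟨m + 1, m - 1, n + 1, n - 1, -r * (j ^ 2 - j),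
    -r * (j ^ 2 - j) - (2 * j - 1) * r, by ring, by ring,
    by linear_combination -(2 * j - 1) * r * h⟩

theorem reprDiffSqUT_sixteen_mul_eight_mul {k l r : ℤ} :
    ReprDiffSqUT !![16 * k, r; 0, 8 * l] :=
  reprDiffSqUT_iff.2 ⟨2 * k + 2, 2 * k - 2, -2 * l - 1, -2 * l + 1, r * (1 - (k - l)),
    -(k - l) * r, by ring, by ring, by ring⟩

theorem sq_sub_sq_odd_or_four_mul (a b : ℤ) :
    (a % 2 = 1 ∧ b % 2 = 0 ∧ (a ^ 2 - b ^ 2) % 4 = 1) ∨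
      (a % 2 = 0 ∧ b % 2 = 1 ∧ (a ^ 2 - b ^ 2) % 4 = 3) ∨
      ∃ u v : ℤ, a = v + u ∧ b = v - u ∧ a ^ 2 - b ^ 2 = 4 * (u * v) := by
  obtain ⟨m, rfl | rfl⟩ := Int.even_or_odd' a <;> obtain ⟨n, rfl | rfl⟩ := Int.even_or_odd' b
  · exact .inr (.inr ⟨m - n, m + n, by ring, by ring, by ring⟩)
  · ring_nf; omega
  · ring_nf; omega
  · exact .inr (.inr ⟨m - n, m + n + 1, by ring, by ring, by ring⟩)

/-- If `u * v` and `s * t` are both odd, or both congruent to `2` modulo `4`, then the sum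
`v + u + (t + s)` is even. -/
theorem two_dvd_of_mul_emod_four {u v s t : ℤ}
    (h : u * v % 2 = 1 ∧ s * t % 2 = 1 ∨ u * v % 4 = 2 ∧ s * t % 4 = 2) :
    2 ∣ v + u + (t + s) := by
  obtain ⟨a, rfl | rfl⟩ := Int.even_or_odd' u <;> obtain ⟨b, rfl | rfl⟩ := Int.even_or_odd' v <;>
    obtain ⟨c, rfl | rfl⟩ := Int.even_or_odd' s <;> obtain ⟨d, rfl | rfl⟩ := Int.even_or_odd' t <;>
    ring_nf at h <;> omega

theorem four_dvd_of_mul_emod_four_eq {u v s t : ℤ}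
    (h : (u * v) % 4 = 1 ∧ (s * t) % 4 = 1 ∨ (u * v) % 4 = 3 ∧ (s * t) % 4 = 3) :
    4 ∣ v + u + (t + s) ∧ 4 ∣ v - u + (t - s) := by
  have key : ∀ u v s t : ZMod 4, (u * v = 1 ∧ s * t = 1 ∨ u * v = 3 ∧ s * t = 3) →
      v + u + (t + s) = 0 ∧ v - u + (t - s) = 0 := by decide
  have cast (x c : ℤ) (hx : x % 4 = c % 4) : (x : ZMod 4) = c :=
    (ZMod.intCast_eq_intCast_iff _ _ 4).2 hx
  have := key u v s t (h.imp
    (fun h => ⟨by simpa using cast (u * v) 1 h.1, by simpa using cast (s * t) 1 h.2⟩)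
    (fun h => ⟨by simpa using cast (u * v) 3 h.1, by simpa using cast (s * t) 3 h.2⟩))
  exact ⟨(ZMod.intCast_zmod_eq_zero_iff_dvd _ 4).1 (by push_cast; exact this.1),
    (ZMod.intCast_zmod_eq_zero_iff_dvd _ 4).1 (by push_cast; exact this.2)⟩

theorem final_classification (p q r : ℤ) :
    ReprDiffSqUT !![p, r; 0, q] ↔
      (Odd p ∧ Odd q ∧
        ((p ≡ q [ZMOD 4] ∧ r ≡ 0 [ZMOD 2]) ∨ ¬ p ≡ q [ZMOD 4])) ∨
      ((Odd p ∧ 4 ∣ q) ∨ (Odd q ∧ 4 ∣ p)) ∨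
      (p ≡ 0 [ZMOD 4] ∧ q ≡ 0 [ZMOD 4] ∧
        (((p % 16, q % 16) ∈ ({(4, 4), (12, 12)} : Set (ℤ × ℤ)) ∧ r ≡ 0 [ZMOD 4]) ∨
         ((p % 16, q % 16) ∈ ({(4, 12), (8, 8), (12, 4)} : Set (ℤ × ℤ)) ∧ r ≡ 0 [ZMOD 2]) ∨
         (p % 16, q % 16) ∉
           ({(4, 4), (12, 12), (4, 12), (8, 8), (12, 4)} : Set (ℤ × ℤ)))) := by
  simp only [Int.ModEq, Set.mem_insert_iff, Set.mem_singleton_iff, Prod.mk.injEq, Int.odd_iff]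
  constructor
  · intro h
    obtain ⟨a, b, d, e, x, y, rfl, rfl, rfl⟩ := reprDiffSqUT_iff.1 h
    have dvd_r {c : ℤ} (h₁ : c ∣ a + d) (h₂ : c ∣ b + e) : c ∣ x * (a + d) - y * (b + e) :=
      dvd_sub (h₁.mul_left x) (h₂.mul_left y)
    have even_r : 2 ∣ a + d → 2 ∣ b + e → 2 ∣ x * (a + d) - y * (b + e) := dvd_r
    have four_r : 4 ∣ a + d → 4 ∣ b + e → 4 ∣ x * (a + d) - y * (b + e) := dvd_r
    clear h dvd_r
    generalize x * (a + d) - y * (b + e) = r at *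
    have hp := sq_sub_sq_odd_or_four_mul a b
    have hq := sq_sub_sq_odd_or_four_mul d e
    generalize a ^ 2 - b ^ 2 = p at *
    generalize d ^ 2 - e ^ 2 = q at *
    obtain hp | hp | ⟨u, v, rfl, rfl, rfl⟩ := hp <;>
      obtain hq | hq | ⟨s, t, rfl, rfl, rfl⟩ := hq <;> try omega
    have h₂ := @two_dvd_of_mul_emod_four u v s t
    have h₄ := @four_dvd_of_mul_emod_four_eq u v s t
    generalize u * v = P at *
    generalize s * t = Q at *
    omega
  · rintro (⟨hp, hq, h⟩ | (⟨hp, hq⟩ | ⟨hq, hp⟩) | ⟨hp, hq, h⟩)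
    · obtain ⟨m, rfl⟩ : ∃ m, p = 2 * m + 1 := ⟨p / 2, by omega⟩
      obtain ⟨n, rfl⟩ : ∃ n, q = 2 * n + 1 := ⟨q / 2, by omega⟩
      obtain ⟨-, h⟩ | h := h
      · obtain ⟨k, rfl⟩ : ∃ k, r = 2 * k := ⟨r / 2, by omega⟩
        exact reprDiffSqUT_odd_odd_of_even
      · exact reprDiffSqUT_odd_odd_of_odd_add (j := (m + n) / 2) (by omega)
    · obtain ⟨m, rfl⟩ : ∃ m, p = 2 * m + 1 := ⟨p / 2, by omega⟩
      obtain ⟨n, rfl⟩ := hq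
      exact reprDiffSqUT_odd_four_mul
    · obtain ⟨n, rfl⟩ : ∃ n, q = 2 * n + 1 := ⟨q / 2, by omega⟩
      obtain ⟨m, rfl⟩ := hp
      exact reprDiffSqUT_odd_four_mul.swap
    · obtain ⟨m, rfl⟩ : ∃ m, p = 4 * m := ⟨p / 4, by omega⟩
      obtain ⟨n, rfl⟩ : ∃ n, q = 4 * n := ⟨q / 4, by omega⟩
      obtain ⟨-, h⟩ | ⟨h, hr⟩ | h := h
      · obtain ⟨k, rfl⟩ : ∃ k, r = 4 * k := ⟨r / 4, by omega⟩
        exact reprDiffSqUT_four_mul_of_four_dvd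
      · obtain ⟨k, rfl⟩ : ∃ k, r = 2 * k := ⟨r / 2, by omega⟩
        exact reprDiffSqUT_four_mul_of_even (j := (m + n) / 4) (by omega)
      · obtain hmn | ⟨hm, hn⟩ | ⟨hm, hn⟩ :
            (m + n) % 2 = 1 ∨ (m % 4 = 0 ∧ n % 2 = 0) ∨ (m % 2 = 0 ∧ n % 4 = 0) := by
          rw [show 4 * m % 16 = 4 * (m % 4) by omega, show 4 * n % 16 = 4 * (n % 4) by omega] at h
          obtain hm | hm | hm | hm : m % 4 = 0 ∨ m % 4 = 1 ∨ m % 4 = 2 ∨ m % 4 = 3 := by omega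
          all_goals
            norm_num [hm] at h
            omega
        · exact reprDiffSqUT_four_mul_of_odd_add (j := (m + n) / 2) (by omega)
        · rw [show 4 * m = 16 * (m / 4) by omega, show 4 * n = 8 * (n / 2) by omega]
          exact reprDiffSqUT_sixteen_mul_eight_mul
        · rw [show 4 * m = 8 * (m / 2) by omega, show 4 * n = 16 * (n / 4) by omega]
          exact reprDiffSqUT_sixteen_mul_eight_mul.swap
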